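/- Let 𝒱 be a set, (𝒲, ‖·‖) a Banach space, and b_n : 𝒱 → 𝒲, n ∈ ℕ, a sequence of uniformly bounded and uniformly almost periodic functions. Then for every ε > 0 there exists N ∈ ℕ such that for all n ≥ m ≥ N, all k ∈ ℕ and all V ∈ 𝒱: ‖ (1/n) Σ_{j=1}^n b_j(V) − (1/m) Σ_{j=1}^m b_{j+k}(V) ‖ ≤ ε. -/

import Mathlib

/-- A sequence of maps `b_n : 𝒱 → 𝒲` (`n ∈ ℕ`, `n ≥ 1`, here indexed so that `b (n+1)`
is the `(n+1)`-st map) is uniformly almost periodic if for every `ε > 0` there exists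
`P ∈ ℕ` such that for every `V` and every `ℓ ≥ 1` there exists `p ∈ {ℓ, …, ℓ+P}` with
`‖b_n(V) − b_{n+p}(V)‖ ≤ ε` for all `n ≥ 1`. -/
def UnifAlmostPeriodic {𝒱 𝒲 : Type*} [NormedAddCommGroup 𝒲] (b : ℕ → 𝒱 → 𝒲) : Prop :=
  ∀ ε > (0 : ℝ), ∃ P : ℕ, ∀ V : 𝒱, ∀ ℓ : ℕ, 1 ≤ ℓ →
    ∃ p : ℕ, ℓ ≤ p ∧ p ≤ ℓ + P ∧ ∀ n : ℕ, 1 ≤ n → ‖b n V - b (n + p) V‖ ≤ ε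

open Finset in
/-- Shifting a window of length `m` by a `δ`-almost period plus a bounded amount `P` changes
the window sum by at most `m * δ + 2 * P * C`. -/
theorem norm_sum_window_sub_le {E : Type*} [NormedAddCommGroup E] {f : ℕ → E} {C δ : ℝ} {P : ℕ}
    (hC : ∀ j, ‖f j‖ ≤ C) (hδ : 0 ≤ δ)
    (hf : ∀ k, 1 ≤ k → ∃ p, k ≤ p ∧ p ≤ k + P ∧ ∀ j, ‖f j - f (j + p)‖ ≤ δ) (k m : ℕ) :
    ‖∑ j ∈ range m, f (k + j) - ∑ j ∈ range m, f j‖ ≤ m * δ + 2 * P * C := by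
  have hC0 : 0 ≤ C := (norm_nonneg _).trans (hC 0)
  rcases Nat.eq_zero_or_pos k with rfl | hk
  · simp only [zero_add, sub_self, norm_zero]
    positivity
  obtain ⟨p, hkp, hpP, hp⟩ := hf k hk
  obtain ⟨q, rfl⟩ := Nat.exists_eq_add_of_le hkp
  have hqP : (q : ℝ) ≤ P := by exact_mod_cast (by omega : q ≤ P)
  have window (a : ℕ) : ‖∑ j ∈ range q, f (a + j)‖ ≤ P * C := by
    refine (norm_sum_le_of_le _ fun j _ => hC (a + j)).trans ?_
    rw [sum_const, card_range, nsmul_eq_mul]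
    gcongr
  have shift : ‖∑ j ∈ range m, f j - ∑ j ∈ range m, f (k + q + j)‖ ≤ m * δ := by
    rw [← sum_sub_distrib]
    refine (norm_sum_le_of_le _ fun j _ => ?_).trans_eq (b := ∑ _j ∈ range m, δ) ?_
    · rw [add_comm (k + q) j]
      exact hp j
    · simp
  have split : ∑ j ∈ range q, f (k + j) + ∑ j ∈ range m, f (k + q + j)
      = ∑ j ∈ range m, f (k + j) + ∑ j ∈ range q, f (k + m + j) := by
    have h₁ := sum_range_add (fun j => f (k + j)) q m
    have h₂ := sum_range_add (fun j => f (k + j)) m q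
    rw [add_comm q m] at h₁
    simpa only [add_assoc] using h₁.symm.trans h₂
  have decomp : ∑ j ∈ range m, f (k + j) - ∑ j ∈ range m, f j
      = ∑ j ∈ range q, f (k + j) - ∑ j ∈ range q, f (k + m + j)
        - (∑ j ∈ range m, f j - ∑ j ∈ range m, f (k + q + j)) := by
    rw [eq_sub_of_add_eq split.symm]
    abel
  rw [decomp]
  linarith [norm_sub_le (∑ j ∈ range q, f (k + j) - ∑ j ∈ range q, f (k + m + j))
    (∑ j ∈ range m, f j - ∑ j ∈ range m, f (k + q + j)),
    norm_sub_le (∑ j ∈ range q, f (k + j)) (∑ j ∈ range q, f (k + m + j)),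
    window k, window (k + m)]

open Finset in
/-- If all window sums of length `m` are within `B` of the initial one, then the sum over `r`
consecutive windows is within `r * B` of `r` times the initial window sum. -/
theorem norm_sum_range_mul_sub_smul_le {E : Type*} [NormedAddCommGroup E] [NormedSpace ℝ E]
    {f : ℕ → E} {B : ℝ} {m : ℕ}
    (h : ∀ k, ‖∑ j ∈ range m, f (k + j) - ∑ j ∈ range m, f j‖ ≤ B) (r : ℕ) :
    ‖∑ j ∈ range (r * m), f j - (r : ℝ) • ∑ j ∈ range m, f j‖ ≤ r * B := by
  induction r with
  | zero => simp
  | succ r ih =>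
    have e : ∑ j ∈ range ((r + 1) * m), f j - ((r + 1 : ℕ) : ℝ) • ∑ j ∈ range m, f j
        = (∑ j ∈ range (r * m), f j - (r : ℝ) • ∑ j ∈ range m, f j)
          + (∑ j ∈ range m, f (r * m + j) - ∑ j ∈ range m, f j) := by
      rw [Nat.succ_mul, sum_range_add, Nat.cast_succ, add_smul, one_smul]
      abel
    rw [e]
    push_cast
    linarith [norm_add_le (∑ j ∈ range (r * m), f j - (r : ℝ) • ∑ j ∈ range m, f j)
      (∑ j ∈ range m, f (r * m + j) - ∑ j ∈ range m, f j), h (r * m)]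

open Finset in
/-- If window sums of every length `m` are within `m * δ + D` of the initial ones, then the
initial average of length `n` and any average of length `m` are close. -/
theorem norm_average_sub_average_le {E : Type*} [NormedAddCommGroup E] [NormedSpace ℝ E]
    {f : ℕ → E} {δ D : ℝ}
    (h : ∀ k m : ℕ, ‖∑ j ∈ range m, f (k + j) - ∑ j ∈ range m, f j‖ ≤ m * δ + D)
    {m n : ℕ} (hm : 0 < m) (hn : 0 < n) (k : ℕ) :
    ‖(1 / (n : ℝ)) • ∑ j ∈ range n, f j - (1 / (m : ℝ)) • ∑ j ∈ range m, f (k + j)‖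
      ≤ 3 * δ + (2 / m + 1 / n) * D := by
  have hm' : (0 : ℝ) < m := by exact_mod_cast hm
  have hn' : (0 : ℝ) < n := by exact_mod_cast hn
  have hnm := norm_sum_range_mul_sub_smul_le (h · m) n
  have hmn := norm_sum_range_mul_sub_smul_le (h · n) m
  rw [mul_comm m n] at hmn
  have hk := h k m
  set T := ∑ j ∈ range (n * m), f j
  set Sm := ∑ j ∈ range m, f j
  set Sn := ∑ j ∈ range n, f j
  set Sk := ∑ j ∈ range m, f (k + j)
  have e : (1 / (n : ℝ)) • Sn - (1 / (m : ℝ)) • Sk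
      = (1 / ((n : ℝ) * m)) • ((T - (n : ℝ) • Sm) - (T - (m : ℝ) • Sn) - (n : ℝ) • (Sk - Sm)) := by
    have h₁ : (1 / (n : ℝ)) = (1 / ((n : ℝ) * m)) * m := by field_simp
    have h₂ : (1 / (m : ℝ)) = (1 / ((n : ℝ) * m)) * n := by field_simp
    rw [h₁, h₂, mul_smul, mul_smul, ← smul_sub, smul_sub (n : ℝ)]
    congr 1
    abel
  have hsmul : ‖(n : ℝ) • (Sk - Sm)‖ ≤ n * (m * δ + D) := by
    rw [norm_smul, Real.norm_of_nonneg hn'.le]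
    gcongr
  have hsum : ‖(T - (n : ℝ) • Sm) - (T - (m : ℝ) • Sn) - (n : ℝ) • (Sk - Sm)‖
      ≤ n * (m * δ + D) + m * (n * δ + D) + n * (m * δ + D) := by
    linarith [norm_sub_le ((T - (n : ℝ) • Sm) - (T - (m : ℝ) • Sn)) ((n : ℝ) • (Sk - Sm)),
      norm_sub_le (T - (n : ℝ) • Sm) (T - (m : ℝ) • Sn)]
  rw [e, norm_smul, Real.norm_of_nonneg (by positivity)]
  refine (mul_le_mul_of_nonneg_left hsum (by positivity)).trans_eq ?_
  field_simp
  ring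

/-- For a uniformly bounded, uniformly almost periodic sequence of maps
`b_n : 𝒱 → 𝒲` into a Banach space, for every `ε > 0` there is `N` such that for all
`n ≥ m ≥ N`, `k ≥ 1` and `V`:
`‖(1/n) Σ_{j=1}^n b_j(V) − (1/m) Σ_{j=1}^m b_{j+k}(V)‖ ≤ ε`. -/
theorem cesaro_estimate_of_unifAlmostPeriodic
    {𝒱 𝒲 : Type*} [NormedAddCommGroup 𝒲] [NormedSpace ℝ 𝒲] [CompleteSpace 𝒲]
    (b : ℕ → 𝒱 → 𝒲)
    (hbd : ∃ C : ℝ, ∀ n : ℕ, 1 ≤ n → ∀ V : 𝒱, ‖b n V‖ ≤ C)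
    (hap : UnifAlmostPeriodic b) :
    ∀ ε > (0 : ℝ), ∃ N : ℕ, ∀ m n : ℕ, N ≤ m → m ≤ n → ∀ k : ℕ, 1 ≤ k → ∀ V : 𝒱,
      ‖(1 / (n : ℝ)) • ∑ j ∈ Finset.range n, b (j + 1) V -
        (1 / (m : ℝ)) • ∑ j ∈ Finset.range m, b (j + 1 + k) V‖ ≤ ε := by
  intro ε hε
  obtain ⟨C, hC⟩ := hbd
  obtain ⟨P, hP⟩ := hap (ε / 6) (by positivity)
  obtain ⟨N, hN⟩ := exists_nat_gt (12 * P * C / ε)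
  refine ⟨N + 1, fun m n hm hmn k _ V => ?_⟩
  have hf : ∀ j, ‖b (j + 1) V‖ ≤ C := fun j => hC (j + 1) (by omega) V
  have hC0 : 0 ≤ C := (norm_nonneg _).trans (hf 0)
  have hwindow := norm_sum_window_sub_le (f := fun j => b (j + 1) V) (P := P) hf
    (by positivity : 0 ≤ ε / 6) fun l hl => by
      obtain ⟨p, hlp, hpl, hp⟩ := hP V l hl
      refine ⟨p, hlp, hpl, fun j => ?_⟩
      simpa only [add_right_comm j 1 p] using hp (j + 1) (by omega)
  have key := norm_average_sub_average_le (f := fun j => b (j + 1) V) hwindow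
    (by omega : 0 < m) (by omega : 0 < n) k
  have hcomm (j : ℕ) : j + 1 + k = k + j + 1 := by omega
  simp only [hcomm]
  refine key.trans ?_
  have hm0 : (0 : ℝ) < m := by exact_mod_cast (by omega : 0 < m)
  have hmn' : (m : ℝ) ≤ n := by exact_mod_cast hmn
  have hNm : (N : ℝ) ≤ m := by exact_mod_cast (by omega : N ≤ m)
  have hlarge : 12 * P * C ≤ m * ε := ((div_lt_iff₀ hε).1 (hN.trans_le hNm)).le
  have hinv : (2 / m + 1 / n : ℝ) ≤ 3 / m := by
    have : (1 / n : ℝ) ≤ 1 / m := one_div_le_one_div_of_le hm0 hmn'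
    linarith [show (3 / m : ℝ) = 2 / m + 1 / m by ring]
  have hrest : (2 / m + 1 / n : ℝ) * (2 * P * C) ≤ ε / 2 := calc
    (2 / m + 1 / n : ℝ) * (2 * P * C) ≤ 3 / m * (2 * P * C) := by gcongr
    _ = 6 * P * C / m := by ring
    _ ≤ ε / 2 := by
      rw [div_le_iff₀ hm0]
      linarith
  linarith
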